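/- Let σ be a field automorphism of F_q with σ ≠ id, and suppose n > 2 or σ² ≠ id. Then every nonzero (n+1)×(n+1) matrix M over F_q satisfies either wt(c_M) = q^{2n−1} − q^{n−1} or wt(c_M) ≥ q^{2n−1}, and wt(c_M) = q^{2n−1} (the second lowest weight of C(Λ_σ)) holds if and only if M has rank 1, say M = a·β with a a nonzero column vector and β a nonzero row vector, and β·a^σ = 0 (i.e. the associated hyperplane of the point-hyperplane geometry is singular). -/

import Mathlib

open Matrix

/-- `wt σ M` : the Hamming weight of the codeword `c_M` of `C(Λ_σ)`, i.e. the number of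
pairs of projective points `([x],[ξ])` with `ξ·x = 0` and `ξ·M·x^σ ≠ 0`. -/
noncomputable def wt {F : Type} [Field F] [Fintype F] {n : ℕ}
    (σ : F ≃+* F) (M : Matrix (Fin (n + 1)) (Fin (n + 1)) F) : ℕ :=
  Nat.card {pq : Projectivization F (Fin (n + 1) → F) × Projectivization F (Fin (n + 1) → F) //
    pq.2.rep ⬝ᵥ pq.1.rep = 0 ∧ (pq.2.rep ᵥ* M) ⬝ᵥ (fun i => σ (pq.1.rep i)) ≠ 0}

theorem card_ker_mulVec {F : Type*} [Field F] [Fintype F] {k N : ℕ}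
    (A : Matrix (Fin k) (Fin N) F) :
    Nat.card {v : Fin N → F // A *ᵥ v = 0} = Fintype.card F ^ (N - A.rank) := by
  have h1 : Nat.card {v : Fin N → F // A *ᵥ v = 0} = Nat.card (LinearMap.ker A.mulVecLin) :=
    Nat.card_congr (Equiv.subtypeEquivRight fun v => by simp)
  have h2 := A.mulVecLin.finrank_range_add_finrank_ker
  rw [h1, Module.natCard_eq_pow_finrank (K := F), Nat.card_eq_fintype_card]
  congr 1
  rw [Module.finrank_fin_fun] at h2
  unfold Matrix.rank
  omega

theorem card_orthogonal_one {F : Type*} [Field F] [Fintype F] {n : ℕ}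
    {x : Fin (n + 1) → F} (hx : x ≠ 0) :
    Nat.card {v : Fin (n + 1) → F // v ⬝ᵥ x = 0} = Fintype.card F ^ n := by
  have h : LinearIndependent F ![x] := by
    rw [linearIndependent_unique_iff]; simpa using hx
  have := card_ker_mulVec (Matrix.of ![x])
  rw [LinearIndependent.rank_matrix (M := Matrix.of ![x]) h] at this
  simp only [Fintype.card_fin, Nat.add_sub_cancel] at this
  rw [← this]
  refine Nat.card_congr (Equiv.subtypeEquivRight fun v => ?_)
  rw [funext_iff]
  simp [Matrix.mulVec, dotProduct_comm]

theorem card_orthogonal_two {F : Type*} [Field F] [Fintype F] {n : ℕ}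
    {x y : Fin (n + 1) → F} (h : LinearIndependent F ![x, y]) :
    Nat.card {v : Fin (n + 1) → F // v ⬝ᵥ x = 0 ∧ v ⬝ᵥ y = 0} = Fintype.card F ^ (n - 1) := by
  have := card_ker_mulVec (Matrix.of ![x, y])
  rw [LinearIndependent.rank_matrix (M := Matrix.of ![x, y]) h] at this
  simp only [Fintype.card_fin, Nat.reduceSubDiff] at this
  rw [← this]
  refine Nat.card_congr (Equiv.subtypeEquivRight fun v => ?_)
  rw [funext_iff]
  simp [Matrix.mulVec, dotProduct_comm, Fin.forall_fin_two]

theorem card_orthogonal_diff {F : Type*} [Field F] [Fintype F] {n : ℕ}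
    {x y : Fin (n + 1) → F} (hx : x ≠ 0) (hy : ∀ c : F, y ≠ c • x) :
    Nat.card {v : Fin (n + 1) → F // v ⬝ᵥ x = 0 ∧ v ⬝ᵥ y ≠ 0} + Fintype.card F ^ (n - 1) =
      Fintype.card F ^ n := by
  classical
  have h : LinearIndependent F ![x, y] := by
    rw [LinearIndependent.pair_iff' hx]
    exact fun c hc => hy c hc.symm
  rw [← card_orthogonal_one hx, ← card_orthogonal_two h]
  simp only [Nat.card_eq_fintype_card, Fintype.card_subtype]
  rw [← Finset.card_filter_add_card_filter_not (s := Finset.univ.filter fun v => v ⬝ᵥ x = 0)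
    (fun v => v ⬝ᵥ y = 0), Finset.filter_filter, Finset.filter_filter, add_comm]

/-- The number of vectors `x`, including `0`, such that `M x^σ` is a multiple of `x`. -/
noncomputable def cardFixed {F : Type*} [Field F] {N : ℕ}
    (σ : F ≃+* F) (M : Matrix (Fin N) (Fin N) F) : ℕ :=
  Nat.card {x : Fin N → F // ∃ c : F, M *ᵥ (fun i => σ (x i)) = c • x}

theorem card_flags {F : Type} [Field F] [Fintype F] {n : ℕ}
    (σ : F ≃+* F) (M : Matrix (Fin (n + 1)) (Fin (n + 1)) F) :
    Nat.card {v : (Fin (n + 1) → F) × (Fin (n + 1) → F) //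
      v.2 ⬝ᵥ v.1 = 0 ∧ (v.2 ᵥ* M) ⬝ᵥ (fun i => σ (v.1 i)) ≠ 0} =
    wt σ M * (Fintype.card F - 1) ^ 2 := by
  classical
  have hs : ∀ (c d : F) (x y : Fin (n + 1) → F),
      (d • y) ⬝ᵥ (c • x) = d * c * (y ⬝ᵥ x) ∧
      ((d • y) ᵥ* M) ⬝ᵥ (fun i => σ ((c • x) i)) =
        d * σ c * ((y ᵥ* M) ⬝ᵥ (fun i => σ (x i))) := by
    intro c d x y
    have : (fun i => σ ((c • x) i)) = σ c • fun i => σ (x i) := by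
      ext i; simp
    rw [this, smul_vecMul]
    simp only [smul_dotProduct, dotProduct_smul, smul_eq_mul]
    constructor <;> ring
  have hu : (Fintype.card F - 1) = Nat.card Fˣ := by
    rw [Nat.card_eq_fintype_card, Fintype.card_units]
  rw [hu, pow_two, ← Nat.card_prod, wt, ← Nat.card_prod]
  symm
  refine Nat.card_congr (Equiv.ofBijective (fun p =>
    ⟨((p.2.1 : F) • p.1.1.1.rep, (p.2.2 : F) • p.1.1.2.rep), ?_⟩) ⟨?_, ?_⟩)
  · have := p.1.2
    rw [(hs _ _ _ _).1, (hs _ _ _ _).2]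
    simpa using this
  · have key : ∀ (p p' : Projectivization F (Fin (n + 1) → F)) (c c' : Fˣ),
        (c : F) • p.rep = (c' : F) • p'.rep → p = p' ∧ c = c' := by
      intro p p' c c' h
      have hp : p = p' := by
        rw [← p.mk_rep, ← p'.mk_rep, Projectivization.mk_eq_mk_iff']
        refine ⟨(c : F)⁻¹ * c', ?_⟩
        rw [mul_smul, ← h, smul_smul, inv_mul_cancel₀ c.ne_zero, one_smul]
      subst hp
      exact ⟨rfl, Units.ext (smul_left_injective F p.rep_nonzero h)⟩
    rintro ⟨⟨⟨p, p'⟩, hp⟩, c, c'⟩ ⟨⟨⟨r, r'⟩, hr⟩, d, d'⟩ h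
    simp only [Subtype.mk.injEq, Prod.mk.injEq] at h
    obtain ⟨rfl, rfl⟩ := key _ _ _ _ h.1
    obtain ⟨rfl, rfl⟩ := key _ _ _ _ h.2
    rfl
  · rintro ⟨⟨x, y⟩, hxy⟩
    have hx : x ≠ 0 := by
      rintro rfl
      exact hxy.2 (by simp [dotProduct])
    have hy : y ≠ 0 := by
      rintro rfl
      exact hxy.2 (by simp)
    obtain ⟨c, hc⟩ := Projectivization.exists_smul_eq_mk_rep F x hx
    obtain ⟨d, hd⟩ := Projectivization.exists_smul_eq_mk_rep F y hy
    have hc' : x = ((c⁻¹ : Fˣ) : F) • (Projectivization.mk F x hx).rep := by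
      rw [← hc, ← Units.smul_def, smul_smul, inv_mul_cancel, one_smul]
    have hd' : y = ((d⁻¹ : Fˣ) : F) • (Projectivization.mk F y hy).rep := by
      rw [← hd, ← Units.smul_def, smul_smul, inv_mul_cancel, one_smul]
    refine ⟨⟨⟨(Projectivization.mk F x hx, Projectivization.mk F y hy), ?_⟩, c⁻¹, d⁻¹⟩, ?_⟩
    · rw [← hc, ← hd]
      simp only [Units.smul_def]
      rw [(hs _ _ _ _).1, (hs _ _ _ _).2]
      simpa using hxy
    · exact Subtype.ext (Prod.ext hc'.symm hd'.symm)

theorem wt_mul_add {F : Type} [Field F] [Fintype F] {n : ℕ} (hn : 1 ≤ n)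
    (σ : F ≃+* F) (M : Matrix (Fin (n + 1)) (Fin (n + 1)) F) :
    wt σ M * (Fintype.card F - 1) + Fintype.card F ^ (n - 1) * cardFixed σ M =
      Fintype.card F ^ (n - 1) * Fintype.card F ^ (n + 1) := by
  classical
  have hq : 1 < Fintype.card F := Fintype.one_lt_card
  have hf := card_flags σ M
  have hb : ∀ x : Fin (n + 1) → F,
      Nat.card {y : Fin (n + 1) → F //
        y ⬝ᵥ x = 0 ∧ (y ᵥ* M) ⬝ᵥ (fun i => σ (x i)) ≠ 0} =
      if ∃ c : F, M *ᵥ (fun i => σ (x i)) = c • x then 0 else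
        (Fintype.card F - 1) * Fintype.card F ^ (n - 1) := by
    intro x
    simp only [← dotProduct_mulVec]
    split_ifs with h
    · obtain ⟨c, hc⟩ := h
      rw [hc]
      have : IsEmpty {y : Fin (n + 1) → F // y ⬝ᵥ x = 0 ∧ y ⬝ᵥ (c • x) ≠ 0} :=
        ⟨fun y => y.2.2 (by simp [y.2.1])⟩
      exact Nat.card_of_isEmpty
    · push Not at h
      have hx : x ≠ 0 := by
        rintro rfl
        exact h 0 (by ext; simp [mulVec, dotProduct])
      have h3 := card_orthogonal_diff hx h
      obtain ⟨m, rfl⟩ : ∃ m, n = m + 1 := ⟨n - 1, by omega⟩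
      obtain ⟨r, hr⟩ : ∃ r, Fintype.card F = r + 1 := ⟨Fintype.card F - 1, by omega⟩
      rw [hr] at h3 ⊢
      simp only [Nat.add_sub_cancel] at h3 ⊢
      rw [pow_succ] at h3
      linarith
  have e : {v : (Fin (n + 1) → F) × (Fin (n + 1) → F) //
      v.2 ⬝ᵥ v.1 = 0 ∧ (v.2 ᵥ* M) ⬝ᵥ (fun i => σ (v.1 i)) ≠ 0} ≃
      Σ x : Fin (n + 1) → F, {y : Fin (n + 1) → F //
        y ⬝ᵥ x = 0 ∧ (y ᵥ* M) ⬝ᵥ (fun i => σ (x i)) ≠ 0} :=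
    Equiv.subtypeProdEquivSigmaSubtype
      (fun x y : Fin (n + 1) → F => y ⬝ᵥ x = 0 ∧ (y ᵥ* M) ⬝ᵥ (fun i => σ (x i)) ≠ 0)
  rw [Nat.card_congr e, Nat.card_sigma, Finset.sum_congr rfl (fun x _ => hb x),
    Finset.sum_ite, Finset.sum_const_zero, zero_add, Finset.sum_const, smul_eq_mul] at hf
  have hc : cardFixed σ M + (Finset.univ.filter fun x : Fin (n + 1) → F =>
      ¬ ∃ c : F, M *ᵥ (fun i => σ (x i)) = c • x).card = Fintype.card F ^ (n + 1) := by
    rw [cardFixed, Nat.card_eq_fintype_card, Fintype.card_subtype,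
      Finset.card_filter_add_card_filter_not]
    simp
  rw [← hc]
  have hq' : 0 < Fintype.card F - 1 := by omega
  have : wt σ M * (Fintype.card F - 1) = Fintype.card F ^ (n - 1) *
      (Finset.univ.filter fun x : Fin (n + 1) → F =>
        ¬ ∃ c : F, M *ᵥ (fun i => σ (x i)) = c • x).card := by
    refine Nat.eq_of_mul_eq_mul_right hq' ?_
    linarith
  rw [this]
  ring

theorem exists_card_semilinear_le {F : Type*} [Field F] [Fintype F] (σ : F ≃+* F)
    (hσ : σ ≠ RingEquiv.refl F) :
    ∃ q₀ : ℕ, 2 ≤ q₀ ∧ q₀ ^ 2 ≤ Fintype.card F ∧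
      (σ.trans σ ≠ RingEquiv.refl F → q₀ ^ 3 ≤ Fintype.card F) ∧
      ∀ c : F, Nat.card {x : F // σ x = c * x} ≤ q₀ := by
  classical
  let K : Subfield F := (σ : F →+* F).eqLocusField (RingHom.id F)
  let s : F ≃ₐ[K] F := AlgEquiv.ofRingEquiv (f := σ) (fun x => x.2)
  have h1 : s ≠ 1 := fun h => hσ (RingEquiv.ext fun x => DFunLike.congr_fun h x)
  have hcard : Fintype.card F = Nat.card K ^ Module.finrank K F := by
    rw [← Nat.card_eq_fintype_card, Module.natCard_eq_pow_finrank (K := K)]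
  have hle := AlgEquiv.card_le (F := K) (K := F)
  have hK : 1 < Nat.card K := Finite.one_lt_card
  refine ⟨Nat.card K, hK, ?_, ?_, ?_⟩
  · rw [hcard]
    refine Nat.pow_le_pow_right (by omega) (le_trans ?_ hle)
    have : ({1, s} : Finset (F ≃ₐ[K] F)).card = 2 := Finset.card_pair h1.symm
    exact this ▸ Finset.card_le_univ _
  · intro h2
    have h2 : s * s ≠ 1 := fun h => h2 (RingEquiv.ext fun x => DFunLike.congr_fun h x)
    rw [hcard]
    refine Nat.pow_le_pow_right (by omega) (le_trans ?_ hle)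
    have : ({1, s, s * s} : Finset (F ≃ₐ[K] F)).card = 3 := by
      rw [Finset.card_eq_three]
      exact ⟨1, s, s * s, h1.symm, h2.symm, fun h => h1 (by simpa using h.symm), rfl⟩
    exact this ▸ Finset.card_le_univ _
  · intro c
    by_cases h : ∃ y : F, y ≠ 0 ∧ σ y = c * y
    · obtain ⟨y, hy, hyc⟩ := h
      refine Nat.card_le_card_of_injective
        (fun x : {x : F // σ x = c * x} => (⟨x.1 / y, ?_⟩ : K)) ?_
      · have hc : c ≠ 0 := by
          rintro rfl
          simp [hy] at hyc
        change σ (x.1 / y) = x.1 / y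
        rw [map_div₀, x.2, hyc, mul_div_mul_left _ _ hc]
      · intro x x' h
        simp only [Subtype.mk.injEq] at h
        exact Subtype.ext ((div_left_inj' hy).1 h)
    · push Not at h
      have : Subsingleton {x : F // σ x = c * x} := by
        refine ⟨fun x x' => Subtype.ext ?_⟩
        have h0 : ∀ z : {x : F // σ x = c * x}, z.1 = 0 := fun z => by
          by_contra hz
          exact h _ hz z.2
        rw [h0, h0]
      exact (Finite.card_le_one_iff_subsingleton.2 this).trans hK.le

theorem card_diagonal_eigenvectors_le {F : Type*} [Field F] [Fintype F] (σ : F ≃+* F) {q₀ : ℕ}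
    (hq₀ : 2 ≤ q₀) (hc : ∀ c : F, Nat.card {x : F // σ x = c * x} ≤ q₀) (k : ℕ)
    (l : Fin k → F) (hl : ∀ i, l i ≠ 0) :
    Nat.card {x : Fin k → F // ∃ c, ∀ i, σ (x i) * l i = c * x i} ≤
      1 + (Fintype.card F - 1) * (q₀ ^ k - 1) := by
  classical
  induction k with
  | zero => exact (Finite.card_le_one_iff_subsingleton.2 inferInstance).trans (by simp)
  | succ k ih =>
    have ih := ih (fun i => l i.succ) (fun i => hl _)
    have hT : ∀ y : Fˣ, Nat.card {t : Fin k → F // ∀ i,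
        σ (t i) = (σ y * l 0 / y / l i.succ) * t i} ≤ q₀ ^ k := by
      intro y
      rw [Nat.card_congr (Equiv.subtypePiEquivPi (p := fun (i : Fin k) (z : F) =>
        σ z = (σ y * l 0 / y / l i.succ) * z)), Nat.card_pi]
      exact (Finset.prod_le_prod' fun i _ => hc _).trans (by simp)
    have hinj : Nat.card {x : Fin (k + 1) → F // ∃ c, ∀ i, σ (x i) * l i = c * x i} ≤
        Nat.card ({x : Fin k → F // ∃ c, ∀ i, σ (x i) * l i.succ = c * x i} ⊕
          (Σ y : Fˣ, {t : Fin k → F // ∀ i,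
            σ (t i) = (σ y * l 0 / y / l i.succ) * t i})) := by
      refine Nat.card_le_card_of_injective (fun x =>
        if h : x.1 0 = 0 then Sum.inl ⟨Fin.tail x.1, ?_⟩ else
          Sum.inr ⟨Units.mk0 _ h, Fin.tail x.1, ?_⟩) ?_
      · obtain ⟨c, hc⟩ := x.2
        exact ⟨c, fun i => hc _⟩
      · obtain ⟨c, hc⟩ := x.2
        intro i
        have h0 := hc 0
        have h1 := hc i.succ
        have := hl i.succ
        simp only [Units.val_mk0, Fin.tail]
        field_simp
        rw [h0]
        linear_combination x.1 0 * h1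
      · intro x x' h
        refine Subtype.ext ?_
        dsimp only at h
        rw [← Fin.cons_self_tail x.1, ← Fin.cons_self_tail x'.1]
        split_ifs at h with h1 h2 h2
        · simp only [Sum.inl.injEq, Subtype.mk.injEq] at h
          rw [h1, h2, h]
        · simp only [Sum.inr.injEq, Sigma.mk.injEq] at h
          obtain ⟨h3, h4⟩ := h
          have h3 := congrArg Units.val h3
          simp only [Units.val_mk0] at h3
          rw [Subtype.heq_iff_coe_eq] at h4
          · simp only at h4
            rw [h3, h4]
          · intro t
            simp only [Units.val_mk0, h3]
    refine hinj.trans ?_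
    rw [Nat.card_sum, Nat.card_sigma]
    have h2 := Finset.sum_le_card_nsmul (Finset.univ : Finset Fˣ) _ _ (fun y _ => hT y)
    rw [Finset.card_univ, Fintype.card_units, smul_eq_mul] at h2
    refine (Nat.add_le_add ih h2).trans ?_
    rw [add_assoc, ← mul_add]
    gcongr
    have : 1 ≤ q₀ ^ k := Nat.one_le_pow _ _ (by omega)
    have : q₀ ^ k * 2 ≤ q₀ ^ (k + 1) := by rw [pow_succ]; gcongr
    omega

theorem card_eigenvectors_le {F : Type*} [Field F] [Fintype F] (σ : F ≃+* F) {q₀ N : ℕ}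
    (hq₀ : 2 ≤ q₀) (hc : ∀ c : F, Nat.card {x : F // σ x = c * x} ≤ q₀)
    (M : Matrix (Fin N) (Fin N) F) :
    Nat.card {x : Fin N → F // x ≠ 0 ∧ ∃ c : F, c ≠ 0 ∧ M *ᵥ (fun i => σ (x i)) = c • x} ≤
      (Fintype.card F - 1) * (q₀ ^ N - 1) := by
  classical
  let S : Set (Fin N → F) := {x | x ≠ 0 ∧ ∃ c : F, c ≠ 0 ∧ M *ᵥ (fun i => σ (x i)) = c • x}
  obtain ⟨b, hbS, hspan, hli⟩ := exists_linearIndependent F S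
  have : Fintype b := Fintype.ofFinite b
  have hk : Fintype.card b ≤ N := by
    simpa using hli.fintype_card_le_finrank
  let e := Fintype.equivFin b
  let u : Fin (Fintype.card b) → Fin N → F := fun i => (e.symm i).1
  have hu : LinearIndependent F u := hli.comp _ e.symm.injective
  have hru : Set.range u = b := by
    have : u = Subtype.val ∘ e.symm := rfl
    rw [this, Set.range_comp, e.symm.surjective.range_eq]
    simp
  have hmem : ∀ x ∈ S, ∃ t : Fin (Fintype.card b) → F, ∑ i, t i • u i = x := by
    intro x hx
    rw [← Submodule.mem_span_range_iff_exists_fun, hru, hspan]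
    exact Submodule.subset_span hx
  have huS : ∀ i, ∃ c : F, c ≠ 0 ∧ M *ᵥ (fun j => σ (u i j)) = c • u i :=
    fun i => (hbS (e.symm i).2).2
  choose l hl0 hl using huS
  choose! t ht using hmem
  have hcard := card_diagonal_eigenvectors_le σ hq₀ hc _ l hl0
  have hz : Nat.card {x : Fin (Fintype.card b) → F // ∃ c, ∀ i, σ (x i) * l i = c * x i} =
      Nat.card {x : Fin (Fintype.card b) → F // x ≠ 0 ∧ ∃ c, ∀ i, σ (x i) * l i = c * x i}
        + 1 := by
    simp only [Nat.card_eq_fintype_card, Fintype.card_subtype]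
    rw [← Finset.card_filter_add_card_filter_not (s := Finset.univ.filter
      fun x : Fin (Fintype.card b) → F => ∃ c, ∀ i, σ (x i) * l i = c * x i)
      (fun x => x ≠ 0), Finset.filter_filter, Finset.filter_filter]
    congr 1
    · congr 1
      ext x
      simp [and_comm]
    · rw [Finset.card_eq_one]
      refine ⟨0, ?_⟩
      ext x
      simp only [ne_eq, not_not, Finset.mem_filter, Finset.mem_univ, true_and,
        Finset.mem_singleton, and_iff_right_iff_imp]
      rintro rfl
      exact ⟨0, by simp⟩
  have hinj : Nat.card S ≤
      Nat.card {x : Fin (Fintype.card b) → F // x ≠ 0 ∧ ∃ c, ∀ i, σ (x i) * l i = c * x i} := by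
    refine Nat.card_le_card_of_injective (fun x => ⟨t x.1, ?_, ?_⟩) ?_
    · intro h0
      have := ht x.1 x.2
      rw [h0] at this
      exact x.2.1 (by simpa using this.symm)
    · obtain ⟨c, -, hcx⟩ := x.2.2
      refine ⟨c, fun i => ?_⟩
      have hx := ht x.1 x.2
      have h1 : (fun j => σ (x.1 j)) = ∑ i, σ (t x.1 i) • fun j => σ (u i j) := by
        conv_lhs => rw [← hx]
        ext j
        simp [Finset.sum_apply]
      rw [h1, mulVec_sum] at hcx
      simp only [mulVec_smul, hl] at hcx
      conv_rhs at hcx => rw [← hx, Finset.smul_sum]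
      have h2 : ∑ i, (σ (t x.1 i) * l i - c * t x.1 i) • u i = 0 := by
        simp only [sub_smul, mul_smul, Finset.sum_sub_distrib]
        rw [hcx, sub_self]
      exact sub_eq_zero.1 (Fintype.linearIndependent_iff.1 hu _ h2 i)
    · intro x x' h
      simp only [Subtype.mk.injEq] at h
      refine Subtype.ext ?_
      rw [← ht x.1 x.2, ← ht x'.1 x'.2, h]
  have : (Fintype.card F - 1) * (q₀ ^ Fintype.card b - 1) ≤
      (Fintype.card F - 1) * (q₀ ^ N - 1) := by
    gcongr
    omega
  refine hinj.trans ?_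
  omega

theorem card_subtype_twist {F : Type*} [Field F] {N : ℕ} (σ : F ≃+* F)
    (p : (Fin N → F) → Prop) :
    Nat.card {x : Fin N → F // p (fun i => σ (x i))} = Nat.card {y : Fin N → F // p y} :=
  Nat.card_congr ((Equiv.piCongrRight fun _ : Fin N => σ.toEquiv).subtypeEquiv fun _ => Iff.rfl)

theorem cardFixed_lt_of_two_le_rank {F : Type*} [Field F] [Fintype F] {n : ℕ} (hn : 2 ≤ n)
    (σ : F ≃+* F) (hσ : σ ≠ RingEquiv.refl F) (hcase : 2 < n ∨ σ.trans σ ≠ RingEquiv.refl F)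
    (M : Matrix (Fin (n + 1)) (Fin (n + 1)) F) (hM : 2 ≤ M.rank) :
    cardFixed σ M < Fintype.card F ^ n := by
  classical
  obtain ⟨q₀, hq₀, h2, h3, hc⟩ := exists_card_semilinear_le σ hσ
  have hq : 1 < Fintype.card F := Fintype.one_lt_card
  have hpow : q₀ ^ (n + 1) ≤ Fintype.card F ^ (n - 1) := by
    by_cases hn2 : 2 < n
    · calc q₀ ^ (n + 1) ≤ q₀ ^ (2 * (n - 1)) := Nat.pow_le_pow_right (by omega) (by omega)
        _ = (q₀ ^ 2) ^ (n - 1) := pow_mul _ _ _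
        _ ≤ _ := Nat.pow_le_pow_left h2 _
    · obtain rfl : n = 2 := by omega
      simpa using h3 (hcase.resolve_left hn2)
  have hker : Nat.card {x : Fin (n + 1) → F // M *ᵥ (fun i => σ (x i)) = 0} ≤
      Fintype.card F ^ (n - 1) := by
    rw [card_subtype_twist σ (fun y => M *ᵥ y = 0), card_ker_mulVec]
    exact Nat.pow_le_pow_right (by omega) (by omega)
  have heig := card_eigenvectors_le σ hq₀ hc M
  have hsplit : cardFixed σ M ≤
      Nat.card {x : Fin (n + 1) → F // M *ᵥ (fun i => σ (x i)) = 0} +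
      Nat.card {x : Fin (n + 1) → F // x ≠ 0 ∧
        ∃ c : F, c ≠ 0 ∧ M *ᵥ (fun i => σ (x i)) = c • x} := by
    rw [cardFixed]
    simp only [Nat.card_eq_fintype_card, Fintype.card_subtype]
    refine le_trans (Finset.card_le_card fun x hx => ?_) (Finset.card_union_le _ _)
    simp only [Finset.mem_filter, Finset.mem_univ, true_and, Finset.mem_union] at hx ⊢
    obtain ⟨c, hx⟩ := hx
    by_cases h0 : M *ᵥ (fun i => σ (x i)) = 0
    · exact Or.inl h0
    · refine Or.inr ⟨?_, c, ?_, hx⟩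
      · rintro rfl
        exact h0 (by rw [hx, smul_zero])
      · rintro rfl
        exact h0 (by rw [hx, zero_smul])
  have hmul : (Fintype.card F - 1) * (q₀ ^ (n + 1) - 1) ≤
      (Fintype.card F - 1) * (Fintype.card F ^ (n - 1) - 1) := by gcongr
  have hlt : Fintype.card F ^ (n - 1) +
      (Fintype.card F - 1) * (Fintype.card F ^ (n - 1) - 1) < Fintype.card F ^ n := by
    obtain ⟨m, rfl⟩ : ∃ m, n = m + 1 := ⟨n - 1, by omega⟩
    have : 1 ≤ Fintype.card F ^ m := Nat.one_le_pow _ _ (by omega)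
    rw [Nat.add_sub_cancel, pow_succ]
    obtain ⟨r, hr⟩ : ∃ r, Fintype.card F ^ m = r + 1 := ⟨Fintype.card F ^ m - 1, by omega⟩
    obtain ⟨s, hs⟩ : ∃ s, Fintype.card F = s + 2 := ⟨Fintype.card F - 2, by omega⟩
    rw [hr, hs]
    simp only [Nat.add_sub_cancel, show s + 2 - 1 = s + 1 by omega]
    nlinarith
  omega

theorem exists_eq_vecMulVec_of_rank_le_one {F : Type*} [Field F] {m n : ℕ}
    (M : Matrix (Fin m) (Fin n) F) (hM : M.rank ≤ 1) :
    ∃ (a : Fin m → F) (β : Fin n → F), M = vecMulVec a β := by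
  obtain ⟨v, hv⟩ := finrank_le_one_iff.1 hM
  choose c hc using hv
  refine ⟨v, fun j => c ⟨M.mulVecLin (Pi.single j 1), LinearMap.mem_range_self _ _⟩, ?_⟩
  ext i j
  have h := congrArg (fun w : LinearMap.range M.mulVecLin => (w : Fin m → F) i)
    (hc ⟨M.mulVecLin (Pi.single j 1), LinearMap.mem_range_self _ _⟩)
  have h1 : (M.mulVecLin (Pi.single j 1)) i = M i j := by simp
  rw [vecMulVec_apply, mul_comm, ← h1]
  exact h.symm

theorem vecMulVec_mulVec_eq_smul {F : Type*} [Field F] {m n : ℕ} (a : Fin m → F)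
    (β y : Fin n → F) : vecMulVec a β *ᵥ y = (β ⬝ᵥ y) • a := by
  rw [vecMulVec_mulVec]
  simp

theorem card_twisted_hyperplane {F : Type*} [Field F] [Fintype F] {n : ℕ} (σ : F ≃+* F)
    {β : Fin (n + 1) → F} (hβ : β ≠ 0) :
    Nat.card {x : Fin (n + 1) → F // β ⬝ᵥ (fun i => σ (x i)) = 0} = Fintype.card F ^ n := by
  rw [card_subtype_twist σ (fun y => β ⬝ᵥ y = 0), ← card_orthogonal_one hβ]
  simp only [dotProduct_comm]

theorem exists_vecMulVec_eq_smul_iff {F : Type*} [Field F] {N : ℕ} (σ : F ≃+* F)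
    {a : Fin N → F} (ha : a ≠ 0) (β x : Fin N → F) :
    (∃ c : F, vecMulVec a β *ᵥ (fun i => σ (x i)) = c • x) ↔
      β ⬝ᵥ (fun i => σ (x i)) = 0 ∨ ∃ d : F, x = d • a := by
  rw [vecMulVec_mulVec_eq_smul]
  constructor
  · rintro ⟨c, hc⟩
    by_cases h : β ⬝ᵥ (fun i => σ (x i)) = 0
    · exact Or.inl h
    · have hc0 : c ≠ 0 := by
        rintro rfl
        simp [h, ha] at hc
      refine Or.inr ⟨c⁻¹ * (β ⬝ᵥ fun i => σ (x i)), ?_⟩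
      rw [mul_smul, hc, smul_smul, inv_mul_cancel₀ hc0, one_smul]
  · rintro (h | ⟨d, hd⟩)
    · exact ⟨0, by simp [h]⟩
    · by_cases hd0 : d = 0
      · exact ⟨0, by simp [hd, hd0, dotProduct]⟩
      · refine ⟨(β ⬝ᵥ fun i => σ (x i)) * d⁻¹, ?_⟩
        conv_rhs => rw [hd]
        rw [smul_smul, mul_assoc, inv_mul_cancel₀ hd0, mul_one, ← hd]

theorem dotProduct_twist_smul {F : Type*} [Field F] {N : ℕ} (σ : F ≃+* F)
    (β a : Fin N → F) (d : F) :
    β ⬝ᵥ (fun i => σ ((d • a) i)) = σ d * (β ⬝ᵥ fun i => σ (a i)) := by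
  have : (fun i => σ ((d • a) i)) = σ d • fun i => σ (a i) := by
    ext i; simp
  rw [this, dotProduct_smul, smul_eq_mul]

theorem cardFixed_vecMulVec_of_eq_zero {F : Type*} [Field F] [Fintype F] {n : ℕ} (σ : F ≃+* F)
    {a β : Fin (n + 1) → F} (ha : a ≠ 0) (hβ : β ≠ 0) (h : β ⬝ᵥ (fun i => σ (a i)) = 0) :
    cardFixed σ (vecMulVec a β) = Fintype.card F ^ n := by
  rw [← card_twisted_hyperplane σ hβ, cardFixed]
  refine Nat.card_congr (Equiv.subtypeEquivRight fun x => ?_)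
  rw [exists_vecMulVec_eq_smul_iff σ ha, or_iff_left_iff_imp]
  rintro ⟨d, rfl⟩
  rw [dotProduct_twist_smul, h, mul_zero]

theorem cardFixed_vecMulVec_of_ne_zero {F : Type*} [Field F] [Fintype F] {n : ℕ} (σ : F ≃+* F)
    {a β : Fin (n + 1) → F} (h : β ⬝ᵥ (fun i => σ (a i)) ≠ 0) :
    cardFixed σ (vecMulVec a β) = Fintype.card F ^ n + (Fintype.card F - 1) := by
  classical
  have ha : a ≠ 0 := by
    rintro rfl
    exact h (by simp [dotProduct])
  have hβ : β ≠ 0 := by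
    rintro rfl
    exact h (by simp)
  have hu : Nat.card Fˣ = Fintype.card F - 1 := by
    rw [Nat.card_eq_fintype_card, Fintype.card_units]
  rw [← card_twisted_hyperplane σ hβ, cardFixed, ← hu, ← Nat.card_sum]
  symm
  refine Nat.card_congr (Equiv.ofBijective (Sum.elim
    (fun x => ⟨x.1, (exists_vecMulVec_eq_smul_iff σ ha β x.1).2 (Or.inl x.2)⟩)
    (fun d => ⟨(d : F) • a, (exists_vecMulVec_eq_smul_iff σ ha β _).2 (Or.inr ⟨d, rfl⟩)⟩))
    ⟨Function.Injective.sumElim ?_ ?_ ?_, ?_⟩)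
  · intro x x' hx
    simpa [Subtype.ext_iff] using hx
  · intro d d' hd
    simp only [Subtype.mk.injEq] at hd
    exact Units.ext (smul_left_injective F ha hd)
  · rintro ⟨x, hx⟩ d hd
    simp only [Subtype.mk.injEq] at hd
    rw [hd, dotProduct_twist_smul] at hx
    simp [h] at hx
  · rintro ⟨x, hx⟩
    by_cases h0 : β ⬝ᵥ (fun i => σ (x i)) = 0
    · exact ⟨Sum.inl ⟨x, h0⟩, rfl⟩
    · obtain ⟨d, rfl⟩ := ((exists_vecMulVec_eq_smul_iff σ ha β x).1 hx).resolve_left h0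
      have hd : d ≠ 0 := by
        rintro rfl
        exact h0 (by simp [dotProduct])
      exact ⟨Sum.inr (Units.mk0 d hd), rfl⟩

theorem stmt_14 (F : Type) [Field F] [Fintype F] (n : ℕ) (hn : 2 ≤ n)
    (σ : F ≃+* F) (hσ : σ ≠ RingEquiv.refl F)
    (hcase : 2 < n ∨ σ.trans σ ≠ RingEquiv.refl F)
    (M : Matrix (Fin (n + 1)) (Fin (n + 1)) F) (hM : M ≠ 0) :
    (wt σ M = (Fintype.card F) ^ (2 * n - 1) - (Fintype.card F) ^ (n - 1) ∨
      (Fintype.card F) ^ (2 * n - 1) ≤ wt σ M) ∧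
    (wt σ M = (Fintype.card F) ^ (2 * n - 1) ↔
      ∃ (a β : Fin (n + 1) → F), a ≠ 0 ∧ β ≠ 0 ∧ M = vecMulVec a β ∧
        β ⬝ᵥ (fun i => σ (a i)) = 0) := by
  have hq : 1 < Fintype.card F := Fintype.one_lt_card
  have hw := wt_mul_add (by omega) σ M
  have hs : 0 < Fintype.card F - 1 := by omega
  have hsub : Fintype.card F ^ (2 * n - 1) - Fintype.card F ^ (n - 1) =
      Fintype.card F ^ (n - 1) * (Fintype.card F ^ n - 1) := by
    rw [Nat.mul_sub, mul_one, ← pow_add]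
    congr 2
    omega
  have h2n : Fintype.card F ^ (2 * n - 1) = Fintype.card F ^ (n - 1) * Fintype.card F ^ n := by
    rw [← pow_add]
    congr 1
    omega
  have hA : 0 < Fintype.card F ^ (n - 1) := Nat.pow_pos (by omega)
  have hB : 0 < Fintype.card F ^ n := Nat.pow_pos (by omega)
  rw [hsub, h2n]
  rw [pow_succ] at hw
  generalize Fintype.card F ^ (n - 1) = A at *
  have hsucc : Fintype.card F = (Fintype.card F - 1) + 1 := by omega
  by_cases hr : 2 ≤ M.rank
  · have hlt := cardFixed_lt_of_two_le_rank hn σ hσ hcase M hr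
    have hgt : A * Fintype.card F ^ n < wt σ M := by
      refine lt_of_mul_lt_mul_right ?_ hs.le
      generalize Fintype.card F ^ n = B at *
      generalize Fintype.card F - 1 = s at *
      rw [hsucc] at hw
      nlinarith
    refine ⟨Or.inr hgt.le, fun h => absurd h hgt.ne', ?_⟩
    rintro ⟨a, β, -, -, rfl, -⟩
    have := rank_vecMulVec_le a β
    omega
  · obtain ⟨a, β, rfl⟩ := exists_eq_vecMulVec_of_rank_le_one M (by omega)
    have ha : a ≠ 0 := by
      rintro rfl
      exact hM (by simp)
    have hβ : β ≠ 0 := by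
      rintro rfl
      exact hM (by simp)
    have heq : β ⬝ᵥ (fun i => σ (a i)) = 0 →
        wt σ (vecMulVec a β) = A * Fintype.card F ^ n := by
      intro h
      rw [cardFixed_vecMulVec_of_eq_zero σ ha hβ h] at hw
      refine Nat.eq_of_mul_eq_mul_right hs ?_
      generalize Fintype.card F ^ n = B at *
      generalize Fintype.card F - 1 = s at *
      rw [hsucc] at hw
      linarith
    have hne : β ⬝ᵥ (fun i => σ (a i)) ≠ 0 →
        wt σ (vecMulVec a β) = A * (Fintype.card F ^ n - 1) := by
      intro h
      rw [cardFixed_vecMulVec_of_ne_zero σ h] at hw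
      refine Nat.eq_of_mul_eq_mul_right hs ?_
      obtain ⟨r, hr⟩ : ∃ r, Fintype.card F ^ n = r + 1 := ⟨Fintype.card F ^ n - 1, by omega⟩
      rw [hr] at hw ⊢
      rw [Nat.add_sub_cancel]
      generalize Fintype.card F - 1 = s at *
      rw [hsucc] at hw
      linarith
    by_cases h : β ⬝ᵥ (fun i => σ (a i)) = 0
    · exact ⟨Or.inr (heq h).ge, fun _ => ⟨a, β, ha, hβ, rfl, h⟩, fun _ => heq h⟩
    · have hlt : A * (Fintype.card F ^ n - 1) < A * Fintype.card F ^ n :=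
        Nat.mul_lt_mul_of_pos_left (by omega) hA
      refine ⟨Or.inl (hne h), fun h' => absurd h' (by rw [hne h]; exact hlt.ne), ?_⟩
      rintro ⟨a', β', ha', hβ', hM', h'⟩
      have h1 := cardFixed_vecMulVec_of_eq_zero σ ha' hβ' h'
      rw [← hM', cardFixed_vecMulVec_of_ne_zero σ h] at h1
      omega
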